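/- For any tree T (a connected acyclic finite simple graph), q(T) ≥ diam(T) + 1. -/

import Mathlib

/-- `S(G)`: real symmetric matrices whose off-diagonal zero-nonzero pattern is given by `G`. -/
def SMat {V : Type*} [Fintype V] [DecidableEq V] (G : SimpleGraph V)
    (A : Matrix V V ℝ) : Prop :=
  A.IsSymm ∧ ∀ i j : V, i ≠ j → (A i j ≠ 0 ↔ G.Adj i j)

/-- `q(A)`: the number of distinct (real) eigenvalues of `A`. -/
noncomputable def qMat {V : Type*} [Fintype V] [DecidableEq V] (A : Matrix V V ℝ) : ℕ :=
  (spectrum ℝ A).ncard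

/-- `q(G)`: the minimum number of distinct eigenvalues over matrices in `S(G)`. -/
noncomputable def qGraph {V : Type*} [Fintype V] [DecidableEq V] (G : SimpleGraph V) : ℕ :=
  sInf {k | ∃ A : Matrix V V ℝ, SMat G A ∧ qMat A = k}

open Polynomial in
/-- A real Hermitian matrix is annihilated by the product of `X - μ` over its distinct
eigenvalues. -/
theorem Matrix.IsHermitian.aeval_prod_spectrum_eq_zero {V : Type*} [Fintype V] [DecidableEq V]
    {A : Matrix V V ℝ} (hA : A.IsHermitian) (hfin : (spectrum ℝ A).Finite) :
    aeval A (∏ μ ∈ hfin.toFinset, (X - C μ)) = 0 := by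
  set p : ℝ[X] := ∏ μ ∈ hfin.toFinset, (X - C μ)
  have hdiag : aeval (Matrix.diagonal hA.eigenvalues) p = 0 := by
    have h := aeval_algHom_apply (Matrix.diagonalAlgHom (n := V) (α := ℝ) ℝ) hA.eigenvalues p
    rw [Matrix.diagonalAlgHom_apply] at h
    rw [h]
    have h0 : aeval hA.eigenvalues p = 0 := by
      ext i
      rw [aeval_pi_apply₂, coe_aeval_eq_eval, eval_prod]
      refine Finset.prod_eq_zero (hfin.mem_toFinset.2 (hA.eigenvalues_mem_spectrum_real i)) ?_
      simp
    rw [h0, map_zero]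
  have hs := hA.spectral_theorem
  have h := aeval_algHom_apply
    (Unitary.conjStarAlgAut ℝ _ hA.eigenvectorUnitary).toAlgEquiv.toAlgHom
    (Matrix.diagonal hA.eigenvalues) p
  rw [hdiag, map_zero] at h
  rw [hs]
  exact h

theorem SMat.pow_apply_eq_zero {V : Type*} [Fintype V] [DecidableEq V] {T : SimpleGraph V}
    {A : Matrix V V ℝ} (hA : SMat T A) (hconn : T.Connected) {k : ℕ} {u v : V}
    (hk : k < T.dist u v) : (A ^ k) u v = 0 := by
  induction k generalizing u with
  | zero =>
    have huv : u ≠ v := by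
      rintro rfl
      simp at hk
    simp [huv]
  | succ k ih =>
    rw [pow_succ', Matrix.mul_apply]
    refine Finset.sum_eq_zero fun w _ => ?_
    by_cases huw : u = w
    · subst huw
      rw [ih (by omega), mul_zero]
    by_cases hadj : T.Adj u w
    · have h1 := SimpleGraph.dist_eq_one_iff_adj.2 hadj
      have h2 := hconn.dist_triangle (u := u) (v := w) (w := v)
      rw [ih (by omega), mul_zero]
    · rw [not_ne_iff.1 (mt (hA.2 u w huw).1 hadj), zero_mul]

theorem SimpleGraph.IsAcyclic.eq_of_adj_of_dist_eq {V : Type*} {T : SimpleGraph V}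
    (hconn : T.Connected) (hacyclic : T.IsAcyclic) {u v w w' : V} (hw : T.Adj u w)
    (hw' : T.Adj u w') (hd : T.dist u v = T.dist w v + 1) (hd' : T.dist u v = T.dist w' v + 1) :
    w = w' := by
  obtain ⟨p, hp⟩ := hconn.exists_walk_length_eq_dist w v
  obtain ⟨p', hp'⟩ := hconn.exists_walk_length_eq_dist w' v
  have h := (hacyclic.subsingleton_path u v).elim
    ⟨_, (SimpleGraph.Walk.cons hw p).isPath_of_length_eq_dist (by simp [hp, hd])⟩
    ⟨_, (SimpleGraph.Walk.cons hw' p').isPath_of_length_eq_dist (by simp [hp', hd'])⟩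
  simpa using congrArg (fun q : T.Path u v => q.1.snd) h

theorem SMat.pow_dist_apply_ne_zero {V : Type*} [Fintype V] [DecidableEq V]
    {T : SimpleGraph V} {A : Matrix V V ℝ} (hA : SMat T A) (hconn : T.Connected)
    (hacyclic : T.IsAcyclic) (u v : V) : (A ^ T.dist u v) u v ≠ 0 := by
  induction hk : T.dist u v generalizing u with
  | zero =>
    obtain rfl := hconn.dist_eq_zero_iff.1 hk
    simp
  | succ k ih =>
    obtain ⟨p, hp⟩ := hconn.exists_walk_length_eq_dist u v
    cases p with
    | nil => simp at hk
    | @cons _ w _ hadj p =>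
      have hle : T.dist w v ≤ k := by
        have := SimpleGraph.dist_le p
        simp only [SimpleGraph.Walk.length_cons] at hp
        omega
      have hwk : T.dist w v = k := by
        have h1 := SimpleGraph.dist_eq_one_iff_adj.2 hadj
        have h2 := hconn.dist_triangle (u := u) (v := w) (w := v)
        omega
      rw [pow_succ', Matrix.mul_apply, Finset.sum_eq_single w]
      · exact mul_ne_zero ((hA.2 u w hadj.ne).2 hadj) (ih w hwk)
      · intro w' _ hne
        by_cases huw : u = w'
        · subst huw
          rw [hA.pow_apply_eq_zero hconn (by omega), mul_zero]
        by_cases hadj' : T.Adj u w'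
        · have h1 := SimpleGraph.dist_eq_one_iff_adj.2 hadj'
          have h2 := hconn.dist_triangle (u := u) (v := w') (w := v)
          have hlt : k < T.dist w' v := by
            by_contra hcon
            exact hne (hacyclic.eq_of_adj_of_dist_eq hconn hadj' hadj (v := v) (by omega)
              (by omega))
          rw [hA.pow_apply_eq_zero hconn hlt, mul_zero]
        · rw [not_ne_iff.1 (mt (hA.2 u w' huw).1 hadj'), zero_mul]
      · simp

open Polynomial in
theorem SMat.dist_lt_qMat {V : Type*} [Fintype V] [DecidableEq V] {T : SimpleGraph V}
    {A : Matrix V V ℝ} (hA : SMat T A) (hconn : T.Connected) (hacyclic : T.IsAcyclic)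
    (u v : V) : T.dist u v < qMat A := by
  by_contra! hle
  have hfin : (spectrum ℝ A).Finite := Matrix.finite_real_spectrum
  set p : ℝ[X] := ∏ μ ∈ hfin.toFinset, (X - C μ) with hp
  have hherm : A.IsHermitian := by
    rw [Matrix.IsHermitian, Matrix.conjTranspose_eq_transpose_of_trivial]
    exact hA.1
  have hpm : p.Monic := monic_prod_of_monic _ _ fun μ _ => monic_X_sub_C μ
  have hdeg : p.natDegree = qMat A := by
    rw [hp, natDegree_prod_of_monic _ _ fun μ _ => monic_X_sub_C μ]
    simp [qMat, Set.ncard_eq_toFinset_card _ hfin]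
  set r : ℝ[X] := X ^ (T.dist u v - qMat A) * p with hr
  have hrm : r.Monic := (monic_X_pow _).mul hpm
  have hrdeg : r.natDegree = T.dist u v := by
    rw [hr, (monic_X_pow _).natDegree_mul hpm, natDegree_X_pow, hdeg]
    omega
  have hr0 : aeval A r = 0 := by
    rw [hr, map_mul, hherm.aeval_prod_spectrum_eq_zero hfin, mul_zero]
  rw [aeval_eq_sum_range, hrdeg, Finset.sum_range_succ, ← hrdeg, hrm.coeff_natDegree, one_smul,
    hrdeg] at hr0
  have h := congrFun (congrFun hr0 u) v
  rw [Matrix.add_apply, Matrix.sum_apply, Finset.sum_eq_zero, zero_add] at h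
  · exact hA.pow_dist_apply_ne_zero hconn hacyclic u v h
  · intro k hk
    rw [Matrix.smul_apply, hA.pow_apply_eq_zero hconn (Finset.mem_range.1 hk), smul_zero]

open Classical in
theorem sMat_adjMatrix {V : Type*} [Fintype V] [DecidableEq V] (G : SimpleGraph V) :
    SMat G (G.adjMatrix ℝ) :=
  ⟨G.isSymm_adjMatrix, fun i j _ => by simp [SimpleGraph.adjMatrix_apply]⟩

/-- For any tree `T`, `q(T) ≥ diam(T) + 1`. -/
theorem stmt_7 {V : Type*} [Fintype V] [DecidableEq V] (T : SimpleGraph V)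
    (hconn : T.Connected) (hacyclic : T.IsAcyclic) :
    T.diam + 1 ≤ qGraph T := by
  have := hconn.nonempty
  obtain ⟨u, v, huv⟩ := T.exists_dist_eq_diam
  refine le_csInf ⟨_, _, sMat_adjMatrix T, rfl⟩ ?_
  rintro _ ⟨A, hA, rfl⟩
  rw [← huv]
  exact hA.dist_lt_qMat hconn hacyclic u v
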